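/- arXiv:1601.01103 — 2 statements merged into one kernel-verified Lean document; each statement's English description precedes it below -/
import Mathlib

section
/- Let R be a chain ring which is an IF-ring. Then every almost FP-injective R-module G is flat, i.e., w.d.(G) = 0. -/
open CategoryTheory

universe u

/-- A chain ring: the lattice of ideals is totally ordered by inclusion. -/
def IsChainRing (R : Type u) [CommRing R] : Prop :=
  ∀ I J : Ideal R, I ≤ J ∨ J ≤ I

/-- The set of zero-divisors of `R`. -/
def zeroDivisorsSet (R : Type u) [CommRing R] : Set R :=
  {r : R | ∃ s : R, s ≠ 0 ∧ r * s = 0}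

/-- An `R`-module `E` is FP-injective if `Ext¹_R(F, E) = 0` for every finitely
presented `R`-module `F`. -/
def IsFPInjective (R : Type u) [CommRing R] (E : Type u) [AddCommGroup E] [Module R E] : Prop :=
  ∀ F : ModuleCat.{u} R, Module.FinitePresentation R F →
    Limits.IsZero (((Ext R (ModuleCat.{u} R) 1).obj (Opposite.op F)).obj (ModuleCat.of R E))

/-- A submodule `D ≤ E` is pure if `0 → D ⊗ N → E ⊗ N` is exact for every module `N`,
i.e. the sequence `0 → D → E → E/D → 0` remains exact after tensoring with any module. -/
def IsPureSubmodule {R : Type u} [CommRing R] {E : Type u} [AddCommGroup E] [Module R E]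
    (D : Submodule R E) : Prop :=
  ∀ (N : Type u) [AddCommGroup N] [Module R N],
    Function.Injective (LinearMap.rTensor N D.subtype)

/-- An `R`-module `G` is almost FP-injective if `G ≅ E/D` for some FP-injective module `E`
and pure submodule `D` of `E`. -/
def IsAlmostFPInjective (R : Type u) [CommRing R] (G : Type u) [AddCommGroup G]
    [Module R G] : Prop :=
  ∃ (E : Type u) (_ : AddCommGroup E) (_ : Module R E) (D : Submodule R E),
    IsFPInjective R E ∧ IsPureSubmodule D ∧ Nonempty ((E ⧸ D) ≃ₗ[R] G)

/-- The weak dimension of a module, as an element of `ℕ∞`: the least `n` such that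
`Tor_{n+1}(M, N) = 0` for all modules `N` (and `⊤ = ∞` if there is no such `n`). -/
noncomputable def weakDim (R : Type u) [CommRing R] (M : Type u) [AddCommGroup M]
    [Module R M] : ℕ∞ :=
  sInf {n : ℕ∞ | ∃ k : ℕ, n = k ∧ ∀ N : ModuleCat.{u} R,
    Limits.IsZero (((Tor (ModuleCat.{u} R) (k + 1)).obj (ModuleCat.of R M)).obj N)}

/-- The projective dimension of a module, as an element of `ℕ∞`: the least `n` such that
`Ext^{n+1}(M, N) = 0` for all modules `N` (and `⊤ = ∞` if there is no such `n`). -/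
noncomputable def projDim (R : Type u) [CommRing R] (M : Type u) [AddCommGroup M]
    [Module R M] : ℕ∞ :=
  sInf {n : ℕ∞ | ∃ k : ℕ, n = k ∧ ∀ N : ModuleCat.{u} R,
    Limits.IsZero (((Ext R (ModuleCat.{u} R) (k + 1)).obj
      (Opposite.op (ModuleCat.of R M))).obj N)}

/-- An IF-ring: every injective module is flat. -/
def IsIFRing (R : Type u) [CommRing R] : Prop :=
  ∀ (M : Type u) [AddCommGroup M] [Module R M], Module.Injective R M → Module.Flat R M

/-- A semicoherent ring: `Hom_R(E, F)` embeds into a flat module for every pair of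
injective modules `E`, `F`. -/
def IsSemicoherent (R : Type u) [CommRing R] : Prop :=
  ∀ (E F : Type u) [AddCommGroup E] [Module R E] [AddCommGroup F] [Module R F],
    Module.Injective R E → Module.Injective R F →
      ∃ (W : Type u) (_ : AddCommGroup W) (_ : Module R W),
        Module.Flat R W ∧ ∃ f : (E →ₗ[R] F) →ₗ[R] W, Function.Injective f

/-- A coherent ring: every finitely generated ideal is finitely presented. -/
def IsCoherentRing (R : Type u) [CommRing R] : Prop :=
  ∀ I : Ideal R, I.FG → Module.FinitePresentation R I

/-- `i : M →ₗ[R] E` exhibits `E` as an injective hull of `M`: `E` is injective and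
`i` is an essential embedding. -/
def IsInjectiveHull (R : Type u) [CommRing R] (M E : Type u) [AddCommGroup M] [Module R M]
    [AddCommGroup E] [Module R E] (i : M →ₗ[R] E) : Prop :=
  Module.Injective R E ∧ Function.Injective i ∧
    ∀ K : Submodule R E, K ≠ ⊥ → K ⊓ LinearMap.range i ≠ ⊥

/-- The bottom prime ideal `M_♯` (as a set): elements killing some nonzero element of `M`. -/
def bottomSet (R : Type u) [CommRing R] (M : Type u) [AddCommGroup M] [Module R M] : Set R :=
  {s : R | ∃ x : M, x ≠ 0 ∧ s • x = 0}

/-- The top prime ideal `M^♯` (as a set): elements `s` with `sM ⊊ M`. -/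
def topSet (R : Type u) [CommRing R] (M : Type u) [AddCommGroup M] [Module R M] : Set R :=
  {s : R | ¬ Function.Surjective fun x : M => s • x}

/-- If `Ext¹(X, Y) = 0`, every `1`-cocycle on a projective resolution of `X` with values in `Y`
is a coboundary. -/
theorem exists_comp_d_eq_of_isZero_ext {R : Type u} [CommRing R] {X Y : ModuleCat.{u} R}
    (P : ProjectiveResolution X)
    (h : Limits.IsZero (((Ext R (ModuleCat.{u} R) 1).obj (Opposite.op X)).obj Y))
    (c : P.complex.X 1 ⟶ Y) (hc : P.complex.d 2 1 ≫ c = 0) :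
    ∃ φ : P.complex.X 0 ⟶ Y, P.complex.d 1 0 ≫ φ = c := by
  have h1 := (HomologicalComplex.exactAt_iff_isZero_homology _ _).2
    (h.of_iso (P.isoExt (R := R) 1 Y).symm)
  rw [HomologicalComplex.exactAt_iff' _ 0 1 2 (by simp) (by simp),
    ShortComplex.moduleCat_exact_iff] at h1
  exact h1 c hc

/-- If `Ext¹(F / range a, E) = 0` and `F` is projective, a map vanishing on the kernel of
`a : L → F` factors through `a`. -/
theorem exists_comp_eq_of_isZero_ext {R : Type u} [CommRing R] {L F E : Type u}
    [AddCommGroup L] [Module R L] [AddCommGroup F] [Module R F] [Module.Projective R F]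
    [AddCommGroup E] [Module R E] (a : L →ₗ[R] F) (x : L →ₗ[R] E)
    (hx : LinearMap.ker a ≤ LinearMap.ker x)
    (h : Limits.IsZero (((Ext R (ModuleCat.{u} R) 1).obj
      (Opposite.op (ModuleCat.of R (F ⧸ LinearMap.range a)))).obj (ModuleCat.of R E))) :
    ∃ y : F →ₗ[R] E, y ∘ₗ a = x := by
  let P := ProjectiveResolution.of (ModuleCat.of R (F ⧸ LinearMap.range a))
  let π : P.complex.X 0 →ₗ[R] F ⧸ LinearMap.range a := (P.π.f 0).hom
  let d : P.complex.X 1 →ₗ[R] P.complex.X 0 := (P.complex.d 1 0).hom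
  have hπ : Function.Surjective π :=
    (ModuleCat.epi_iff_surjective (P.π.f 0)).1 inferInstance
  have hexact : Function.Exact d π :=
    (ShortComplex.ShortExact.moduleCat_exact_iff_function_exact _).1 P.exact₀
  have : Module.Projective R (P.complex.X 0) :=
    (IsProjective.iff_projective _).2 (P.projective 0)
  obtain ⟨α, hα⟩ := Module.projective_lifting_property (LinearMap.range a).mkQ π
    (Submodule.mkQ_surjective _)
  obtain ⟨b, hb⟩ := Module.projective_lifting_property π (LinearMap.range a).mkQ hπ
  have hα' (p) : (LinearMap.range a).mkQ (α p) = π p := LinearMap.congr_fun hα p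
  have hb' (f) : π (b f) = (LinearMap.range a).mkQ f := LinearMap.congr_fun hb f
  let g : LinearMap.range a →ₗ[R] E :=
    (LinearMap.ker a).liftQ x hx ∘ₗ a.quotKerEquivRange.symm.toLinearMap
  have hg (l : L) (hl) : g ⟨a l, hl⟩ = x l := by
    simp [g, LinearMap.quotKerEquivRange_symm_apply_image]
  have hαd (p) : α (d p) ∈ LinearMap.range a :=
    (Submodule.Quotient.mk_eq_zero _).1 ((hα' _).trans (hexact.apply_apply_eq_zero p))
  let c : P.complex.X 1 →ₗ[R] E := g ∘ₗ (α ∘ₗ d).codRestrict _ hαd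
  obtain ⟨φ, hφ⟩ := exists_comp_d_eq_of_isZero_ext P h (ModuleCat.ofHom c) (by
    ext p
    have hd : d ((P.complex.d 2 1).hom p) = 0 :=
      congr($(P.complex.d_comp_d 2 1 0).hom p)
    have : (α ∘ₗ d).codRestrict _ hαd ((P.complex.d 2 1).hom p) = 0 :=
      Subtype.ext (by simp [hd])
    exact (congrArg g this).trans (map_zero g))
  have hφ' (p) : φ.hom (d p) = g ⟨α (d p), hαd p⟩ := congr(ModuleCat.Hom.hom $hφ p)
  have hdiff (f : F) : (LinearMap.id - α ∘ₗ b : F →ₗ[R] F) f ∈ LinearMap.range a :=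
    (Submodule.Quotient.eq _).1 ((hα' _).trans (hb' f)).symm
  refine ⟨φ.hom ∘ₗ b + g ∘ₗ (LinearMap.id - α ∘ₗ b).codRestrict _ hdiff, LinearMap.ext fun l ↦ ?_⟩
  obtain ⟨p, hp⟩ := (hexact (b (a l))).1 (by rw [hb']; simp)
  have hφb : φ.hom (b (a l)) = g ⟨α (b (a l)), hp ▸ hαd p⟩ := by
    simp only [← hp, hφ']
  rw [← hg l ⟨l, rfl⟩]
  simp only [LinearMap.comp_apply, LinearMap.add_apply]
  rw [hφb, ← map_add]
  congr 1
  ext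
  simp

/-- Over an IF-ring, FP-injective modules are flat. -/
theorem IsFPInjective.flat {R : Type u} [CommRing R] (hIF : IsIFRing R)
    {E : Type u} [AddCommGroup E] [Module R E] (hE : IsFPInjective R E) : Module.Flat R E := by
  obtain ⟨J⟩ := EnoughInjectives.presentation (ModuleCat.of R E)
  have hJ : Module.Injective R J.J := (Module.injective_iff_injective_object R J.J).2 J.injective
  have := hIF J.J hJ
  have hi : Function.Injective J.f.hom := (ModuleCat.mono_iff_injective J.f).1 J.mono
  refine Module.Flat.of_forall_exists_factorization fun {l f x} hxf ↦ ?_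
  obtain ⟨k, a, y, hya, haf⟩ := Module.Flat.exists_factorization_of_apply_eq_zero_of_free
    (f := f) (x := J.f.hom ∘ₗ x) (by simp [hxf])
  have hfp : Module.FinitePresentation R ((Fin k →₀ R) ⧸ LinearMap.range a) :=
    Module.finitePresentation_of_surjective (LinearMap.range a).mkQ (Submodule.mkQ_surjective _)
      (by rw [Submodule.ker_mkQ]; exact Submodule.fg_range a)
  obtain ⟨y', hy'⟩ := exists_comp_eq_of_isZero_ext a x (fun v hv ↦ hi <| by
    have := LinearMap.congr_fun hya v
    simpa [LinearMap.mem_ker.1 hv] using this) (hE (ModuleCat.of R _) hfp)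
  exact ⟨k, a, y', hy'.symm, haf⟩

/-- The quotient of a flat module by a pure submodule is flat. -/
theorem IsPureSubmodule.flat_quotient {R : Type u} [CommRing R] {E : Type u} [AddCommGroup E]
    [Module R E] [Module.Flat R E] {D : Submodule R E} (hD : IsPureSubmodule D) :
    Module.Flat R (E ⧸ D) := by
  rw [Module.Flat.iff_lTensor_preserves_injective_linearMap]
  intro N M _ _ _ _ f hf
  rw [injective_iff_map_eq_zero]
  intro t ht
  obtain ⟨e, rfl⟩ := LinearMap.rTensor_surjective N D.mkQ_surjective t
  have hexact (K : Type u) [AddCommGroup K] [Module R K] :=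
    rTensor_exact K (LinearMap.exact_subtype_mkQ D) D.mkQ_surjective
  have hfexact (K : Type u) [AddCommGroup K] [Module R K] :=
    lTensor_exact K (LinearMap.exact_map_mkQ_range f) (Submodule.mkQ_surjective _)
  obtain ⟨s, hs⟩ := (hexact M (f.lTensor E e)).1 (by
    rwa [← LinearMap.comp_apply, LinearMap.rTensor_comp_lTensor, ← LinearMap.lTensor_comp_rTensor])
  obtain ⟨z, rfl⟩ := (hfexact D s).1 (hD _ (by
    rw [← LinearMap.comp_apply, LinearMap.rTensor_comp_lTensor, ← LinearMap.lTensor_comp_rTensor,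
      LinearMap.comp_apply, hs, map_zero]
    exact (hfexact E).apply_apply_eq_zero e))
  have hz : D.subtype.rTensor N z = e :=
    Module.Flat.lTensor_preserves_injective_linearMap (M := E) f hf (by
      rw [← hs, ← LinearMap.comp_apply, ← LinearMap.comp_apply, LinearMap.lTensor_comp_rTensor,
        LinearMap.rTensor_comp_lTensor])
  rw [← hz]
  exact (hexact N).apply_apply_eq_zero z

/-- Flat modules have weak dimension zero. -/
theorem weakDim_eq_zero_of_flat (R : Type u) [CommRing R] (M : Type u) [AddCommGroup M]
    [Module R M] [Module.Flat R M] : weakDim R M = 0 := by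
  refine nonpos_iff_eq_zero.1 (sInf_le ⟨0, by simp, fun N ↦ ?_⟩)
  let P := ProjectiveResolution.of N
  let T := MonoidalCategory.tensorLeft (ModuleCat.of R M)
  refine Limits.IsZero.of_iso ?_ (P.isoLeftDerivedObj T 1)
  refine (HomologicalComplex.exactAt_iff_isZero_homology _ _).1 ?_
  rw [HomologicalComplex.exactAt_iff' _ 2 1 0 (by simp) (by simp)]
  have h : (P.complex.sc' 2 1 0).Exact := P.exact_succ 0
  rw [ShortComplex.ShortExact.moduleCat_exact_iff_function_exact] at h ⊢
  exact Module.Flat.lTensor_exact M h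

/-- Over a chain ring `R` which is an IF-ring, every almost
FP-injective module `G` is flat, i.e. `w.d.(G) = 0`. -/
theorem flat_of_almostFPInjective_of_IF (R : Type u) [CommRing R]
    (hR : IsChainRing R) (hIF : IsIFRing R)
    (G : Type u) [AddCommGroup G] [Module R G] (hG : IsAlmostFPInjective R G) :
    Module.Flat R G ∧ weakDim R G = 0 := by
  obtain ⟨E, _, _, D, hE, hD, ⟨e⟩⟩ := hG
  have := hE.flat hIF
  have := hD.flat_quotient
  have : Module.Flat R G := .of_linearEquiv e.symm
  exact ⟨this, weakDim_eq_zero_of_flat R G⟩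
end

section
/- Let R be a chain ring which is not semicoherent, with set of zero-divisors Z and fraction ring Q = R_Z, and let G be a nonzero almost FP-injective R-module. Then Z ⊗_R G is flat and almost FP-injective, and: (a) w.d.(G) = 2 if Z ⊊ G_♯; (b) w.d.(G) = 0 if G_♯ ∪ G^♯ ⊊ Z; (c) if G_♯ ∪ G^♯ = Z, then either w.d.(G) = 0 or w.d.(G) = 2; more precisely, G is flat if and only if, for every 0 ≠ x ∈ G, the annihilator (0:x) is not of the form Qa for some 0 ≠ a ∈ Z. -/
open CategoryTheory

universe u

open scoped TensorProduct

section ChainRings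

variable {R : Type u} [CommRing R] {M : Type u} [AddCommGroup M] [Module R M]

theorem IsChainRing.dvd_total (hR : IsChainRing R) (a b : R) : a ∣ b ∨ b ∣ a := by
  rcases hR (Ideal.span {a}) (Ideal.span {b}) with h | h
  · exact Or.inr (Ideal.mem_span_singleton.1 (h (Ideal.mem_span_singleton_self a)))
  · exact Or.inl (Ideal.mem_span_singleton.1 (h (Ideal.mem_span_singleton_self b)))

/-- Multiplying a nonzero element by a zero-divisor enlarges its annihilator. -/
theorem IsChainRing.exists_mul_ne_zero (hR : IsChainRing R) {c w z : R} (hw : w ≠ 0)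
    (hwc : c * w = 0) (hzc : z * c ≠ 0) : ∃ e, e * z ≠ 0 ∧ e * (z * c) = 0 := by
  rcases hR.dvd_total z w with ⟨e, rfl⟩ | ⟨e, rfl⟩
  · exact ⟨e, by rwa [mul_comm], by linear_combination hwc⟩
  · exact absurd (by linear_combination e * hwc) hzc

/-- Over a chain ring, elements of `I • N` are single products. -/
theorem IsChainRing.exists_of_mem_smul (hR : IsChainRing R) {I : Ideal R} {N : Submodule R M}
    {x : M} (hx : x ∈ I • N) : ∃ c ∈ I, ∃ n ∈ N, x = c • n := by
  refine Submodule.smul_induction_on hx (fun r hr n hn => ⟨r, hr, n, hn, rfl⟩) ?_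
  rintro _ _ ⟨c, hc, n, hn, rfl⟩ ⟨d, hd, m, hm, rfl⟩
  rcases hR.dvd_total c d with ⟨k, rfl⟩ | ⟨k, rfl⟩
  · exact ⟨c, hc, n + k • m, N.add_mem hn (N.smul_mem _ hm), by rw [smul_add, mul_smul]⟩
  · exact ⟨d, hd, k • n + m, N.add_mem (N.smul_mem _ hn) hm, by rw [smul_add, mul_smul]⟩

/-- Over a chain ring, every element of `I ⊗ M` is a pure tensor. -/
theorem IsChainRing.exists_eq_tmul (hR : IsChainRing R) {I : Ideal R}
    (x : TensorProduct R I M) : ∃ (t : I) (m : M), x = t ⊗ₜ[R] m := by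
  induction x using TensorProduct.induction_on with
  | zero => exact ⟨0, 0, by simp⟩
  | tmul t m => exact ⟨t, m, rfl⟩
  | add x y hx hy =>
    obtain ⟨⟨c, hc⟩, n, rfl⟩ := hx
    obtain ⟨⟨d, hd⟩, m, rfl⟩ := hy
    rcases hR.dvd_total c d with ⟨k, rfl⟩ | ⟨k, rfl⟩
    · refine ⟨⟨c, hc⟩, n + k • m, ?_⟩
      rw [TensorProduct.tmul_add, ← TensorProduct.smul_tmul]
      congr 2
      exact Subtype.ext (mul_comm c k)
    · refine ⟨⟨d, hd⟩, k • n + m, ?_⟩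
      rw [TensorProduct.tmul_add, ← TensorProduct.smul_tmul]
      congr 2
      exact Subtype.ext (mul_comm d k)

theorem IsChainRing.flat_of_forall_smul_eq_zero (hR : IsChainRing R)
    (h : ∀ (a : R) (m : M), a • m = 0 → ∃ c, c * a = 0 ∧ ∃ m', m = c • m') :
    Module.Flat R M := by
  rw [Module.Flat.iff_rTensor_injective]
  intro I _
  rw [injective_iff_map_eq_zero]
  intro x hx
  obtain ⟨⟨a, ha⟩, m, rfl⟩ := hR.exists_eq_tmul x
  have ham : a • m = 0 := by
    simpa using congrArg (TensorProduct.lid R M) hx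
  obtain ⟨c, hca, m', rfl⟩ := h a m ham
  rw [← TensorProduct.smul_tmul]
  have : c • (⟨a, ha⟩ : I) = 0 := Subtype.ext hca
  rw [this, TensorProduct.zero_tmul]

theorem IsChainRing.exists_of_flat (hR : IsChainRing R) [Module.Flat R M] {a : R} {m : M}
    (h : a • m = 0) : ∃ c, c * a = 0 ∧ ∃ m', m = c • m' := by
  obtain ⟨k, c, y, h1, h2⟩ := Module.Flat.isTrivialRelation_of_sum_smul_eq_zero
    (f := fun _ : Fin 1 => a) (x := fun _ : Fin 1 => m) (by simpa using h)
  have hm : m ∈ (Ideal.torsionOf R R a) • (⊤ : Submodule R M) := by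
    have := h1 0
    simp only at this
    rw [this]
    refine Submodule.sum_mem _ fun j _ => Submodule.smul_mem_smul ?_ trivial
    have := h2 j
    rw [Ideal.mem_torsionOf_iff]
    simpa [mul_comm] using this
  obtain ⟨c, hc, n, -, rfl⟩ := hR.exists_of_mem_smul hm
  exact ⟨c, hc, n, rfl⟩

/-- A chain ring with nonzero ideal of zero-divisors `Z`, over whose total ring of fractions
annihilators of nonzero elements are never nonzero principal ideals. -/
structure IsNoncoherentChain (Z : Ideal R) : Prop where
  chain : IsChainRing R
  mem_iff : ∀ {z : R}, z ∈ Z ↔ ∃ s, s ≠ 0 ∧ z * s = 0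
  exists_ne : ∃ z ∈ Z, z ≠ 0
  exists_eq_mul : ∀ {a x : R}, a ≠ 0 → a * x = 0 → ∃ z ∈ Z, ∃ y, a * y = 0 ∧ x = z * y

/-- Elements killed by `z` are divisible by all `b` with `b * z ≠ 0`. -/
def AnnDivisible (R M : Type u) [CommRing R] [AddCommGroup M] [Module R M] : Prop :=
  ∀ (x : M) (z b : R), z • x = 0 → b * z ≠ 0 → ∃ y, x = b • y

theorem eq_zero_of_notMem {Z : Ideal R} (hZ : ∀ {z : R}, z ∈ Z ↔ ∃ s, s ≠ 0 ∧ z * s = 0)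
    {s y : R} (hs : s ∉ Z) (h : s * y = 0) : y = 0 := by
  by_contra hy
  exact hs (hZ.2 ⟨y, hy, h⟩)

theorem sub_notMem {Z : Ideal R} {s z : R} (hs : s ∉ Z) (hz : z ∈ Z) : s - z ∉ Z := by
  intro h
  exact hs (by simpa using Z.add_mem h hz)

namespace IsNoncoherentChain

variable {Z : Ideal R}

theorem mem_of_mul_eq_zero (hZ : IsNoncoherentChain Z)
    {a b : R} (h : a * b = 0) (hb : b ≠ 0) : a ∈ Z :=
  hZ.mem_iff.2 ⟨b, hb, h⟩

theorem eq_zero_of_notMem (hZ : IsNoncoherentChain Z)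
    {s y : R} (hs : s ∉ Z) (h : s * y = 0) : y = 0 := by
  by_contra hy
  exact hs (hZ.mem_of_mul_eq_zero h hy)

theorem exists_mul_ne_zero (hZ : IsNoncoherentChain Z) {c z : R} (hc : c ∈ Z) (hzc : z * c ≠ 0) :
    ∃ e, e * z ≠ 0 ∧ e * (z * c) = 0 := by
  obtain ⟨w, hw, hcw⟩ := hZ.mem_iff.1 hc
  exact hZ.chain.exists_mul_ne_zero hw hcw hzc

theorem flat_ideal (hZ : IsNoncoherentChain Z) : Module.Flat R Z := by
  refine hZ.chain.flat_of_forall_smul_eq_zero ?_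
  rintro a ⟨x, hx⟩ h
  have hax : a * x = 0 := congrArg Subtype.val h
  by_cases ha : a = 0
  · exact ⟨1, by simp [ha], ⟨x, hx⟩, by simp⟩
  · obtain ⟨z, hz, y, hy, rfl⟩ := hZ.exists_eq_mul ha hax
    exact ⟨y, by rw [mul_comm, hy], ⟨z, hz⟩, Subtype.ext (mul_comm z y)⟩

theorem flat_tensorProduct (hZ : IsNoncoherentChain Z)
    (hM : AnnDivisible R M) : Module.Flat R (TensorProduct R Z M) := by
  have hflat := hZ.flat_ideal
  refine hZ.chain.flat_of_forall_smul_eq_zero ?_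
  intro a w hw
  by_cases ha : a = 0
  · exact ⟨1, by simp [ha], w, by simp⟩
  have key : ∀ (t : R) (ht : t ∈ Z) (x : M), a * t = 0 →
      ∃ c, c * a = 0 ∧ ∃ m', (⟨t, ht⟩ : Z) ⊗ₜ[R] x = c • m' := by
    intro t ht x hat
    obtain ⟨z, hz, y, hy, rfl⟩ := hZ.exists_eq_mul ha hat
    refine ⟨y, by rw [mul_comm, hy], (⟨z, hz⟩ : Z) ⊗ₜ[R] x, ?_⟩
    rw [TensorProduct.smul_tmul']
    congr 1
    exact Subtype.ext (mul_comm z y)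
  obtain ⟨⟨t, ht⟩, x, rfl⟩ := hZ.chain.exists_eq_tmul w
  by_cases hat : a * t = 0
  · exact key t ht x hat
  have hv : TensorProduct.VanishesTrivially R (fun _ : Fin 1 => x)
      (fun _ : Fin 1 => a • (⟨t, ht⟩ : Z)) := by
    refine TensorProduct.vanishesTrivially_of_sum_tmul_eq_zero_of_rTensor_injective R
      (Module.Flat.rTensor_preserves_injective_linearMap _ Subtype.val_injective) ?_
    simpa [TensorProduct.smul_tmul'] using congrArg (TensorProduct.comm R Z M) hw
  obtain ⟨k, α, y, h1, h2⟩ := hv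
  have hmem : a * t ∈ Ideal.torsionOf R M x • (Z : Submodule R R) := by
    have := congrArg Subtype.val (h1 0)
    simp only [Submodule.coe_smul, smul_eq_mul, AddSubmonoidClass.coe_finsetSum] at this
    rw [this]
    refine Submodule.sum_mem _ fun j _ => Submodule.smul_mem_smul ?_ (y j).2
    rw [Ideal.mem_torsionOf_iff]
    simpa using h2 j
  obtain ⟨z, hz, t', ht', h⟩ := hZ.chain.exists_of_mem_smul hmem
  rw [smul_eq_mul] at h
  obtain ⟨b, hb, hb'⟩ := hZ.exists_mul_ne_zero ht' (h ▸ hat)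
  obtain ⟨y, rfl⟩ := hM x z b hz hb
  obtain ⟨c, hc, m', hm'⟩ := key (b * t) (Z.mul_mem_left b ht) y
    (by linear_combination b * h + hb')
  refine ⟨c, hc, m', ?_⟩
  rw [← hm', ← TensorProduct.smul_tmul]
  rfl

/-- The second syzygies of a module all of whose elements are sufficiently divisible are flat. -/
theorem flat_ker_ker (hZ : IsNoncoherentChain Z)
    {F F₁ : Type u} [AddCommGroup F] [Module R F] [AddCommGroup F₁]
    [Module R F₁] [Module.Flat R F] [Module.Flat R F₁] (hM : AnnDivisible R M)
    (p : F →ₗ[R] M) (hp : Function.Surjective p) (q : F₁ →ₗ[R] LinearMap.ker p)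
    (hq : Function.Surjective q) : Module.Flat R (LinearMap.ker q) := by
  refine hZ.chain.flat_of_forall_smul_eq_zero ?_
  rintro a ⟨y, hy⟩ h
  by_cases ha : a = 0
  · exact ⟨1, by simp [ha], ⟨y, hy⟩, by simp⟩
  obtain ⟨c, hca, f, rfl⟩ := hZ.chain.exists_of_flat (M := F₁) (congrArg Subtype.val h)
  rw [mul_comm] at hca
  obtain ⟨z, hz, c₁, hc₁, rfl⟩ := hZ.exists_eq_mul ha hca
  have hcf : (z * c₁) • (q f : F) = 0 := by
    have : q ((z * c₁) • f) = 0 := hy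
    rw [map_smul] at this
    exact congrArg Subtype.val this
  obtain ⟨c', hc', m, hm⟩ := hZ.chain.exists_of_flat hcf
  -- `z • q f` lies in the product of the annihilator of `c₁` with the first syzygy
  have key : ∃ r, r * c₁ = 0 ∧ ∃ l : LinearMap.ker p, z • q f = r • l := by
    by_cases hzc : c' * z = 0
    · refine ⟨0, by simp, 0, Subtype.ext ?_⟩
      simp [hm, smul_smul, mul_comm z, hzc]
    obtain ⟨b, hb, hb'⟩ := hZ.exists_mul_ne_zero hz hzc
    have hpm : c' • p m = 0 := by
      rw [← map_smul, ← hm]; exact (q f).2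
    obtain ⟨g, hg⟩ := hM (p m) c' b hpm hb
    obtain ⟨n, rfl⟩ := hp g
    refine ⟨z * c', by linear_combination hc', ⟨m - b • n, by simp [hg]⟩, Subtype.ext ?_⟩
    have : (z * c') • (b • n) = 0 := by
      rw [smul_smul, show z * c' * b = 0 by linear_combination hb', zero_smul]
    simp [hm, smul_sub, smul_smul] at this ⊢
    exact this.symm ▸ (sub_zero _).symm
  obtain ⟨r, hr, l, hl⟩ := key
  obtain ⟨h', rfl⟩ := hq l
  refine ⟨c₁, by rw [mul_comm, hc₁], ⟨z • f - r • h', by simp [hl]⟩, Subtype.ext ?_⟩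
  simp [smul_sub, smul_smul, mul_comm c₁, hr]

/-- If the first syzygy of `M` is flat then so is `M`. -/
theorem flat_of_flat_ker (hZ : IsNoncoherentChain Z)
    {F : Type u} [AddCommGroup F] [Module R F] [Module.Flat R F]
    (hM : AnnDivisible R M) (p : F →ₗ[R] M) (hp : Function.Surjective p)
    [Module.Flat R (LinearMap.ker p)] : Module.Flat R M := by
  refine hZ.chain.flat_of_forall_smul_eq_zero ?_
  intro a x hax
  by_contra! hx
  have ha : a ≠ 0 := by
    rintro rfl
    exact hx 1 (by simp) x (by simp)
  have hx0 : x ≠ 0 := by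
    rintro rfl
    exact hx 0 (by simp) 0 (by simp)
  by_cases haZ : a ∈ Z
  · obtain ⟨d, hd, had⟩ := hZ.mem_iff.1 haZ
    obtain ⟨x', rfl⟩ := hp x
    obtain ⟨c, hcd, l', hl'⟩ := hZ.chain.exists_of_flat (R := R) (a := d)
      (m := (⟨a • x', by simpa using hax⟩ : LinearMap.ker p))
      (Subtype.ext (by simp [smul_smul, mul_comm d, had]))
    have hl : a • x' = c • (l' : F) := congrArg Subtype.val hl'
    have hcZ : c ∈ Z := hZ.mem_of_mul_eq_zero hcd hd
    rcases hZ.chain.dvd_total c a with ⟨z, rfl⟩ | ⟨z, rfl⟩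
    · obtain ⟨c', hcc, f, hf⟩ := hZ.chain.exists_of_flat (R := R) (a := c)
        (m := z • x' - l') (by rw [smul_sub, ← hl, smul_smul, sub_self])
      have hzx : z • p x' = c' • p f := by
        have := congrArg p hf
        simpa using this
      rcases hZ.chain.dvd_total z c' with ⟨k, rfl⟩ | ⟨k, rfl⟩
      · obtain ⟨e, he, he'⟩ := hZ.exists_mul_ne_zero hcZ (z := z) (by rwa [mul_comm])
        obtain ⟨y, hy⟩ := hM (p x' - k • p f) z e
          (by rw [smul_sub, hzx, smul_smul, sub_self]) he
        have hmem : p x' ∈ Ideal.torsionOf R R (c * z) • (⊤ : Submodule R M) := by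
          rw [← sub_add_cancel (p x') (k • p f), hy]
          refine Submodule.add_mem _ (Submodule.smul_mem_smul ?_ trivial)
            (Submodule.smul_mem_smul ?_ trivial)
          · rw [Ideal.mem_torsionOf_iff, smul_eq_mul]; linear_combination he'
          · rw [Ideal.mem_torsionOf_iff, smul_eq_mul]; linear_combination hcc
        obtain ⟨u, hu, n, -, hn⟩ := hZ.chain.exists_of_mem_smul hmem
        exact hx u (by simpa [mul_comm] using hu) n hn
      · exact ha (by linear_combination k * hcc)
    · obtain ⟨k, hk, f, hf⟩ := hZ.chain.exists_of_flat (R := R) (a := a)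
        (m := x' - z • (l' : F)) (by rw [smul_sub, hl, smul_smul, sub_self])
      have := congrArg p hf
      exact hx k hk (p f) (by simpa using this)
  · obtain ⟨d, hdZ, hd⟩ := hZ.exists_ne
    obtain ⟨c, hc, hdc⟩ := hZ.mem_iff.1 hdZ
    obtain ⟨g, rfl⟩ := hM x a c hax
      (fun h => hc (hZ.eq_zero_of_notMem haZ (by rwa [mul_comm])))
    obtain ⟨g, rfl⟩ := hp g
    obtain ⟨c₂, hcd, l', hl'⟩ := hZ.chain.exists_of_flat (R := R) (a := d)
      (m := (⟨(a * c) • g, by simpa [mul_smul] using hax⟩ : LinearMap.ker p))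
      (Subtype.ext (by
        rw [Submodule.coe_smul, smul_smul, show d * (a * c) = 0 by linear_combination a * hdc]
        simp))
    have hl : (a * c) • g = c₂ • (l' : F) := congrArg Subtype.val hl'
    have hc₂ : c₂ ∈ Z := hZ.mem_of_mul_eq_zero hcd hd
    rcases hZ.chain.dvd_total a c₂ with ⟨c₃, rfl⟩ | ⟨k, rfl⟩
    · have h0 : a • (c • g - c₃ • (l' : F)) = 0 := by
        rw [smul_sub, smul_smul, smul_smul, hl, sub_self]
      obtain ⟨u, hu, f, hf⟩ := hZ.chain.exists_of_flat h0
      have hu0 : u = 0 := hZ.eq_zero_of_notMem haZ (by rwa [mul_comm])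
      rw [hu0, zero_smul] at hf
      have := congrArg p hf
      exact hx0 (by simpa using this)
    · exact haZ (Z.mul_mem_right k hc₂)

theorem exists_torsionOf_eq (hZ : IsNoncoherentChain Z) {a : R} {x : M} (hM : AnnDivisible R M)
    (hax : a • x = 0) (hx : ∀ c, c * a = 0 → ∀ m' : M, x ≠ c • m') (r : R) (hr : r • x = 0) :
    ∃ s ∉ Z, ∃ r', s * r = a * r' := by
  have hR := hZ.chain
  have ha : a ≠ 0 := by
    rintro rfl
    exact hx 1 (by simp) x (by simp)
  have h1 : (1 : R) ∉ Z := by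
    intro h
    obtain ⟨s, hs, h⟩ := hZ.mem_iff.1 h
    exact hs (by simpa using h)
  rcases hR.dvd_total a r with ⟨k, rfl⟩ | ⟨m, rfl⟩
  · exact ⟨1, h1, k, by simp⟩
  · by_cases hm : m ∈ Z
    · obtain ⟨b, hb, hb'⟩ := hZ.exists_mul_ne_zero hm ha
      obtain ⟨y, hy⟩ := hM x r b hr hb
      exact absurd hy (hx b hb' y)
    · exact ⟨m, hm, 1, by ring⟩

/-- The flatness criterion for torsion-free modules with divisible elements. -/
theorem flat_iff_torsionOf (hZ : IsNoncoherentChain Z)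
    (hM : AnnDivisible R M) (hb : bottomSet R M ⊆ Z) :
    Module.Flat R M ↔ ∀ x : M, x ≠ 0 → ¬ ∃ a : R, a ≠ 0 ∧ a ∈ Z ∧
      ∀ r, r • x = 0 ↔ ∃ s ∉ Z, ∃ r', s * r = a * r' := by
  have h1 : (1 : R) ∉ Z := by
    intro h
    obtain ⟨s, hs, h⟩ := hZ.mem_iff.1 h
    exact hs (by simpa using h)
  constructor
  · rintro hfl x hx ⟨a, ha, haZ, H⟩
    have hax : a • x = 0 := (H a).2 ⟨1, h1, 1, by ring⟩
    obtain ⟨c, hca, g, rfl⟩ := hZ.chain.exists_of_flat hax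
    rw [mul_comm] at hca
    obtain ⟨z, hz, c', hc', rfl⟩ := hZ.exists_eq_mul ha hca
    rcases hZ.chain.dvd_total a z with ⟨k, rfl⟩ | ⟨w, rfl⟩
    · refine hx ?_
      rw [show a * k * c' = 0 by linear_combination k * hc', zero_smul]
    · obtain ⟨s, hs, r', h⟩ := (H w).1 (by
        rw [smul_smul, show w * (z * c') = 0 by linear_combination hc', zero_smul])
      have hw : w = 0 := hZ.eq_zero_of_notMem (sub_notMem hs (Z.mul_mem_right r' hz))
        (by linear_combination h)
      exact ha (by rw [hw, mul_zero])
  · intro H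
    refine hZ.chain.flat_of_forall_smul_eq_zero ?_
    intro a x hax
    by_contra! hx
    have ha : a ≠ 0 := by
      rintro rfl
      exact hx 1 (by simp) x (by simp)
    have hx0 : x ≠ 0 := by
      rintro rfl
      exact hx 0 (by simp) 0 (by simp)
    refine H x hx0 ⟨a, ha, hb ⟨x, hx0, hax⟩, fun r =>
      ⟨hZ.exists_torsionOf_eq hM hax hx r, ?_⟩⟩
    rintro ⟨s, hs, r', h⟩
    by_contra hrx
    refine hs (hb ⟨r • x, hrx, ?_⟩)
    rw [smul_smul, h, mul_comm, mul_smul, hax, smul_zero]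

theorem flat_of_ssubset (hZ : IsNoncoherentChain Z) (hM : AnnDivisible R M)
    (h : bottomSet R M ∪ topSet R M ⊂ (Z : Set R)) : Module.Flat R M := by
  obtain ⟨z, hz, hz'⟩ := Set.exists_of_ssubset h
  have hb : bottomSet R M ⊆ Z := Set.subset_union_left.trans h.1
  refine hZ.chain.flat_of_forall_smul_eq_zero ?_
  intro a x hax
  by_cases hx0 : x = 0
  · exact ⟨0, by simp, 0, by simp [hx0]⟩
  by_cases ha : a = 0
  · exact ⟨1, by simp [ha], x, by simp⟩
  have hzi : ∀ y : M, z • y = 0 → y = 0 := by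
    intro y hy
    by_contra hy0
    exact hz' (Or.inl ⟨y, hy0, hy⟩)
  rcases hZ.chain.dvd_total a z with ⟨k, rfl⟩ | ⟨r, rfl⟩
  · exact absurd (hzi x (by rw [mul_comm, mul_smul, hax, smul_zero])) hx0
  · obtain ⟨b, hb, hb'⟩ := hZ.exists_mul_ne_zero hz (z := r) (by rwa [mul_comm])
    obtain ⟨y, hy⟩ := hM x r b (hzi _ (by rwa [← mul_smul])) hb
    exact ⟨b, by linear_combination hb', y, hy⟩

end IsNoncoherentChain

end ChainRings

section Semicoherent

variable {R : Type u} [CommRing R]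

theorem Module.Injective.exists_eq_smul {E : Type u} [AddCommGroup E] [Module R E]
    (hE : Module.Injective R E) {b : R} {x : E} (h : ∀ r, r * b = 0 → r • x = 0) :
    ∃ y, x = b • y := by
  let f : (R ⧸ Ideal.torsionOf R R b) →ₗ[R] R :=
    (Ideal.torsionOf R R b).liftQ (LinearMap.toSpanSingleton R R b) fun r hr => by
      simpa using hr
  have hf : Function.Injective f := by
    rw [← LinearMap.ker_eq_bot, LinearMap.ker_eq_bot']
    intro r hr
    obtain ⟨r, rfl⟩ := Submodule.Quotient.mk_surjective _ r
    rw [Submodule.Quotient.mk_eq_zero, Ideal.mem_torsionOf_iff]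
    exact hr
  let g : (R ⧸ Ideal.torsionOf R R b) →ₗ[R] E :=
    (Ideal.torsionOf R R b).liftQ (LinearMap.toSpanSingleton R E x) fun r hr => by
      simpa using h r (by simpa using hr)
  obtain ⟨φ, hφ⟩ := hE.out f hf g
  refine ⟨φ 1, ?_⟩
  have := hφ (Submodule.Quotient.mk 1)
  simp only [f, g, Submodule.liftQ_apply, LinearMap.toSpanSingleton_apply, one_smul] at this
  rw [← this, ← map_smul, smul_eq_mul, mul_one]

theorem Module.exists_injective_embedding (M : Type u) [AddCommGroup M] [Module R M] :
    ∃ (W : Type u) (_ : AddCommGroup W) (_ : Module R W), Module.Injective R W ∧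
      ∃ f : M →ₗ[R] W, Function.Injective f := by
  obtain ⟨⟨J, hJ, f, hf⟩⟩ := EnoughInjectives.presentation (ModuleCat.of R M)
  refine ⟨J, inferInstance, inferInstance, ?_, f.hom, (ModuleCat.mono_iff_injective f).1 hf⟩
  rw [← Module.injective_iff_injective_object] at hJ
  exact hJ

variable {Z : Ideal R}

/-- If annihilators of nonzero elements of `R` become principal over the total ring of fractions,
with the double annihilator property, then `R` is semicoherent. -/
theorem IsChainRing.isSemicoherent (hR : IsChainRing R)
    (hZ : ∀ {z : R}, z ∈ Z ↔ ∃ s, s ≠ 0 ∧ z * s = 0)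
    (h : ∀ a : R, a ≠ 0 → ∃ b, a * b = 0 ∧ ∀ y, b * y = 0 → ∃ s ∉ Z, ∃ r, s * y = r * a) :
    IsSemicoherent R := by
  have hZ' : ∀ {s : R}, s ∉ Z ↔ s ∈ nonZeroDivisors R := by
    intro s
    rw [mem_nonZeroDivisors_iff_right]
    constructor
    · intro hs y hy
      exact _root_.eq_zero_of_notMem hZ hs (by rwa [mul_comm])
    · intro hs hsZ
      obtain ⟨w, hw, h⟩ := hZ.1 hsZ
      exact hw (hs w (by rwa [mul_comm]))
  intro E F _ _ _ _ hE hF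
  let S := nonZeroDivisors R
  let Q := Localization S
  let H := E →ₗ[R] F
  let L := LocalizedModule S H
  obtain ⟨W, _, _, hW, f, hf⟩ := Module.exists_injective_embedding (R := Q) L
  let _ : Module R W := Module.compHom W (algebraMap R Q)
  have : IsScalarTower R Q W := ⟨fun r q w => by
    change (r • q) • w = algebraMap R Q r • (q • w)
    rw [smul_smul, Algebra.smul_def]⟩
  have hcancel : ∀ s ∈ S, ∀ w : W, s • w = 0 → w = 0 := by
    intro s hs w hw
    rw [← algebraMap_smul Q s w] at hw
    exact (IsLocalization.map_units Q (⟨s, hs⟩ : S)).smul_eq_zero.1 hw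
  refine ⟨W, inferInstance, inferInstance, ?_,
    (f.restrictScalars R).comp (LocalizedModule.mkLinearMap S H), ?_⟩
  · refine hR.flat_of_forall_smul_eq_zero ?_
    intro a w haw
    by_cases ha : a = 0
    · exact ⟨1, by simp [ha], w, by simp⟩
    obtain ⟨b, hab, hb⟩ := h a ha
    obtain ⟨y, hy⟩ := hW.exists_eq_smul (b := algebraMap R Q b) (x := w) (by
      intro q hq
      obtain ⟨⟨r, s⟩, hrs⟩ := IsLocalization.surj S q
      have hrb : b * r = 0 := by
        apply IsLocalization.injective Q (le_refl S)
        simp only at hrs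
        rw [map_mul, ← hrs, map_zero]
        linear_combination (algebraMap R Q s) * hq
      obtain ⟨s', hs', r', h⟩ := hb r hrb
      have h1 : r • w = 0 := hcancel s' (hZ'.1 hs') _ (by
        rw [smul_smul, h, mul_smul, haw, smul_zero])
      refine hcancel s s.2 _ ?_
      rw [← algebraMap_smul Q (s : R), smul_smul, mul_comm, hrs, algebraMap_smul, h1])
    exact ⟨b, by rw [mul_comm, hab], y, by rw [hy, algebraMap_smul]⟩
  · refine hf.comp ?_
    intro φ ψ hφ
    obtain ⟨⟨s, hs⟩, h⟩ := (IsLocalizedModule.eq_iff_exists S (LocalizedModule.mkLinearMap S H)).1 hφ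
    refine LinearMap.ext fun e => ?_
    obtain ⟨e', rfl⟩ := hE.exists_eq_smul (b := s) (x := e) (by
      intro r hr
      rw [(mem_nonZeroDivisors_iff_right.1 hs) r hr, zero_smul])
    have := LinearMap.congr_fun h e'
    rw [map_smul, map_smul]
    exact this

/-- `b` generates the annihilator of `a` over the total ring of fractions. -/
def GeneratesAnnihilator (Z : Ideal R) (a b : R) : Prop :=
  a * b = 0 ∧ ∀ y, a * y = 0 → ∃ s ∉ Z, ∃ r, s * y = r * b

theorem IsChainRing.exists_or_exists (hR : IsChainRing R)
    (h1 : (1 : R) ∉ Z) (b y : R) :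
    (∃ s ∉ Z, ∃ r, s * y = r * b) ∨ ∃ z ∈ Z, b = z * y := by
  rcases hR.dvd_total b y with ⟨k, rfl⟩ | ⟨z, rfl⟩
  · exact Or.inl ⟨1, h1, k, by ring⟩
  · by_cases hz : z ∈ Z
    · exact Or.inr ⟨z, hz, mul_comm _ _⟩
    · exact Or.inl ⟨z, hz, 1, by ring⟩

theorem GeneratesAnnihilator.symm (hR : IsChainRing R)
    (hZ : ∀ {z : R}, z ∈ Z ↔ ∃ s, s ≠ 0 ∧ z * s = 0) (h1 : (1 : R) ∉ Z) {a b : R} (ha : a ≠ 0)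
    (h : GeneratesAnnihilator Z a b) : GeneratesAnnihilator Z b a := by
  refine ⟨by rw [mul_comm, h.1], fun y hy => ?_⟩
  rcases hR.exists_or_exists h1 a y with h' | ⟨z, hz, rfl⟩
  · exact h'
  · exfalso
    obtain ⟨w, hw, hzw⟩ := hZ.1 hz
    obtain ⟨e, he, he'⟩ := hR.exists_mul_ne_zero hw hzw (z := y) (by rwa [mul_comm])
    obtain ⟨s, hs, r, hr⟩ := h.2 e (by linear_combination he')
    exact he (_root_.eq_zero_of_notMem hZ hs (by linear_combination y * hr + r * hy))

/-- If one nonzero zero-divisor has principal annihilator over the total ring of fractions, then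
all nonzero elements have. -/
theorem GeneratesAnnihilator.exists_of_ne_zero (hR : IsChainRing R)
    (hZ : ∀ {z : R}, z ∈ Z ↔ ∃ s, s ≠ 0 ∧ z * s = 0) (h1 : (1 : R) ∉ Z) {a₀ x₀ : R}
    (ha₀ : a₀ ≠ 0) (hx₀ : x₀ ≠ 0) (h : GeneratesAnnihilator Z a₀ x₀) {a : R} (ha : a ≠ 0) :
    ∃ b, GeneratesAnnihilator Z a b := by
  have h0 := @_root_.eq_zero_of_notMem R _ Z hZ
  by_cases haZ : a ∈ Z
  · rcases hR.dvd_total a₀ a with ⟨t, rfl⟩ | ⟨t, rfl⟩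
    · rcases hR.dvd_total t x₀ with ⟨b, rfl⟩ | ⟨r, rfl⟩
      · refine ⟨b, by linear_combination h.1, fun y hy => ?_⟩
        rcases hR.exists_or_exists h1 b y with h' | ⟨z, hz, rfl⟩
        · exact h'
        · exfalso
          obtain ⟨s, hs, r, hr⟩ := h.2 (t * y) (by linear_combination hy)
          have hty : t * y = 0 := h0 (sub_notMem hs (Z.mul_mem_left r hz))
            (by linear_combination hr)
          exact hx₀ (by linear_combination z * hty)
      · exact absurd (by linear_combination r * h.1) ha
    · refine ⟨t * x₀, by linear_combination h.1, fun y hy => ?_⟩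
      rcases hR.exists_or_exists h1 (t * x₀) y with h' | ⟨m, hm, hmy⟩
      · exact h'
      · exfalso
        have hs := h.symm hR hZ h1 ha₀
        obtain ⟨s, hsZ, r, hr⟩ := h.2 y (by linear_combination t * hy)
        obtain ⟨s', hs'Z, q, hq⟩ := hs.2 (s * t - m * r) (by
          linear_combination s * hmy + m * hr)
        obtain ⟨s'', hs''Z, p, hp⟩ := hs.2 (r * a) (by
          linear_combination s * hy - a * hr)
        have hZp : ∀ {u v : R}, u ∉ Z → v ∉ Z → u * v ∉ Z := by
          intro u v hu hv huv
          obtain ⟨w, hw, hw'⟩ := hZ.1 huv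
          exact hw (h0 hv (h0 hu (by linear_combination hw')))
        have hσ : s'' * (s' * s - q * a) ∉ Z :=
          hZp hs''Z (sub_notMem (hZp hs'Z hsZ) (Z.mul_mem_left q haZ))
        refine ha₀ (h0 (sub_notMem hσ (Z.mul_mem_right (s' * p) hm)) ?_)
        linear_combination s'' * a * hq + m * s' * hp
  · exact ⟨0, by simp, fun y hy => ⟨1, h1, 0, by simpa using h0 haZ hy⟩⟩

/-- A chain ring which is not semicoherent has no principal annihilators over its total ring of
fractions. -/
theorem IsChainRing.isNoncoherentChain (hR : IsChainRing R) (hns : ¬ IsSemicoherent R)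
    (hZ : ∀ {z : R}, z ∈ Z ↔ ∃ s, s ≠ 0 ∧ z * s = 0) : IsNoncoherentChain Z := by
  have h1 : (1 : R) ∉ Z := by
    intro h
    obtain ⟨s, hs, h⟩ := hZ.1 h
    exact hs (by simpa using h)
  have h0 := @_root_.eq_zero_of_notMem R _ Z hZ
  have hgen : ¬ ∀ a : R, a ≠ 0 → ∃ b, GeneratesAnnihilator Z a b := by
    intro h
    refine hns (hR.isSemicoherent hZ fun a ha => ?_)
    obtain ⟨b, hb⟩ := h a ha
    exact ⟨b, hb.1, (hb.symm hR hZ h1 ha).2⟩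
  refine ⟨hR, hZ, ?_, ?_⟩
  · by_contra! hz
    exact hgen fun a ha => ⟨0, by simp, fun y hy =>
      ⟨1, h1, 0, by simpa using h0 (fun haZ => ha (hz a haZ)) hy⟩⟩
  · intro a x ha hax
    by_contra! hx
    have hx0 : x ≠ 0 := by
      rintro rfl
      exact hx 0 Z.zero_mem 0 (by simp) (by simp)
    refine hgen fun a' ha' => GeneratesAnnihilator.exists_of_ne_zero hR hZ h1 ha hx0
      ⟨hax, fun y hy => ?_⟩ ha'
    rcases hR.exists_or_exists h1 x y with h | ⟨z, hz, h⟩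
    · exact h
    · exact absurd h (hx z hz y hy)

end Semicoherent

section FPInjective

variable {R : Type u} [CommRing R]

theorem isZero_ext_one_iff {F : ModuleCat.{u} R} (P : ProjectiveResolution F)
    (E : ModuleCat.{u} R) :
    Limits.IsZero (((Ext R (ModuleCat.{u} R) 1).obj (Opposite.op F)).obj E) ↔
      ∀ f : P.complex.X 1 ⟶ E, P.complex.d 2 1 ≫ f = 0 → ∃ g, P.complex.d 1 0 ≫ g = f := by
  rw [(P.isoExt (R := R) 1 E).isZero_iff, ← HomologicalComplex.exactAt_iff_isZero_homology,
    HomologicalComplex.exactAt_iff' _ 0 1 2 (by simp) (by simp),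
    ShortComplex.moduleCat_exact_iff]
  rfl

theorem ProjectiveResolution.exists_augmentation {F : ModuleCat.{u} R}
    (P : ProjectiveResolution F) : ∃ π : P.complex.X 0 →ₗ[R] F, Function.Surjective π ∧
      Function.Exact (P.complex.d 1 0).hom π := by
  refine ⟨(P.π.f 0 ≫ (HomologicalComplex.singleObjXSelf (ComplexShape.down ℕ) 0 F).hom).hom,
    (ModuleCat.epi_iff_surjective _).1 inferInstance, ?_⟩
  have := P.exact₀
  rw [ShortComplex.ShortExact.moduleCat_exact_iff_function_exact] at this
  exact this

theorem ProjectiveResolution.projective_X {F : ModuleCat.{u} R} (P : ProjectiveResolution F)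
    (n : ℕ) : Module.Projective R (P.complex.X n) :=
  (IsProjective.iff_projective (P.complex.X n)).2 (P.projective n)

theorem ProjectiveResolution.exact_hom_succ {F : ModuleCat.{u} R} (P : ProjectiveResolution F)
    (n : ℕ) :
    Function.Exact (P.complex.d (n + 2) (n + 1)).hom (P.complex.d (n + 1) n).hom := by
  have := P.exact_succ n
  rw [ShortComplex.ShortExact.moduleCat_exact_iff_function_exact] at this
  exact this

theorem isZero_tor_succ_iff {N : ModuleCat.{u} R} (P : ProjectiveResolution N) (n : ℕ)
    (M : Type u) [AddCommGroup M] [Module R M] :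
    Limits.IsZero (((Tor (ModuleCat.{u} R) (n + 1)).obj (ModuleCat.of R M)).obj N) ↔
      Function.Exact ((P.complex.d (n + 2) (n + 1)).hom.lTensor M)
        ((P.complex.d (n + 1) n).hom.lTensor M) := by
  rw [Tor_obj, (P.isoLeftDerivedObj _ (n + 1)).isZero_iff]
  erw [← HomologicalComplex.exactAt_iff_isZero_homology]
  rw [HomologicalComplex.exactAt_iff' _ (n + 2) (n + 1) n (by simp) (by simp),
    ShortComplex.ShortExact.moduleCat_exact_iff_function_exact]
  rfl

variable {E : Type u} [AddCommGroup E] [Module R E]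

theorem IsFPInjective.exists_eq_smul (hE : IsFPInjective R E) {b : R} {x : E}
    (h : ∀ r, r * b = 0 → r • x = 0) : ∃ y, x = b • y := by
  let F := ModuleCat.of R (R ⧸ Ideal.span {b})
  have hF : Module.FinitePresentation R F :=
    Module.finitePresentation_of_surjective (Ideal.span {b}).mkQ
      (Submodule.mkQ_surjective _)
      (by rw [Submodule.ker_mkQ]; exact ⟨{b}, by simp⟩)
  let P := projectiveResolution F
  have h1 := ProjectiveResolution.projective_X P 1
  have h0 := ProjectiveResolution.projective_X P 0
  obtain ⟨π, hπ, hex⟩ := ProjectiveResolution.exists_augmentation P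
  obtain ⟨i, hi⟩ := Module.projective_lifting_property
    (Ideal.span {b}).mkQ (show P.complex.X 0 →ₗ[R] (R ⧸ Ideal.span {b}) from π)
    (Submodule.mkQ_surjective _)
  have hi' : ∀ u, ∃ r, i ((P.complex.d 1 0).hom u) = r * b := by
    intro u
    have h2 := LinearMap.congr_fun hi ((P.complex.d 1 0).hom u)
    have h3 : π ((P.complex.d 1 0).hom u) = 0 := hex.apply_apply_eq_zero u
    have h4 : (Ideal.span {b}).mkQ (i ((P.complex.d 1 0).hom u)) = 0 := h2.trans h3
    rw [Submodule.mkQ_apply, Submodule.Quotient.mk_eq_zero, Ideal.mem_span_singleton'] at h4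
    obtain ⟨r, hr⟩ := h4
    exact ⟨r, hr.symm⟩
  let β : R →ₗ[R] (Ideal.span {b} : Ideal R) :=
    (LinearMap.toSpanSingleton R R b).codRestrict (Ideal.span {b}) fun r =>
      Ideal.mem_span_singleton'.2 ⟨r, rfl⟩
  obtain ⟨k, hk⟩ := Module.projective_lifting_property β
    ((i ∘ₗ (P.complex.d 1 0).hom).codRestrict (Ideal.span {b}) fun u => by
      obtain ⟨r, hr⟩ := hi' u
      exact Ideal.mem_span_singleton'.2 ⟨r, hr.symm⟩)
    (by
      rintro ⟨_, hr⟩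
      obtain ⟨r, rfl⟩ := Ideal.mem_span_singleton'.1 hr
      exact ⟨r, rfl⟩)
  have hk' : ∀ u, k u * b = i ((P.complex.d 1 0).hom u) := fun u =>
    congrArg Subtype.val (LinearMap.congr_fun hk u)
  obtain ⟨g, hg⟩ := (isZero_ext_one_iff P (ModuleCat.of R E)).1 (hE F hF)
    (ModuleCat.ofHom (LinearMap.toSpanSingleton R E x ∘ₗ k)) (by
      ext u
      refine h _ ?_
      have := hk' ((P.complex.d 2 1).hom u)
      rw [(ProjectiveResolution.exact_hom_succ P 0).apply_apply_eq_zero u, map_zero] at this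
      exact this)
  have hg' : ∀ u, g.hom ((P.complex.d 1 0).hom u) = k u • x := fun u =>
    congrArg (fun φ => φ.hom u) hg
  obtain ⟨p, hp⟩ := hπ (Submodule.Quotient.mk (1 : R))
  have hip : ∃ r, i p = 1 + r * b := by
    have h2 : (Ideal.span {b}).mkQ (i p) = (Ideal.span {b}).mkQ 1 :=
      (LinearMap.congr_fun hi p).trans hp
    rw [← sub_eq_zero, ← map_sub, Submodule.mkQ_apply, Submodule.Quotient.mk_eq_zero,
      Ideal.mem_span_singleton'] at h2
    obtain ⟨r, hr⟩ := h2
    exact ⟨r, by rw [hr]; ring⟩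
  obtain ⟨r, hr⟩ := hip
  obtain ⟨u, hu⟩ := (hex (b • p)).1 (by
    rw [map_smul, hp, ← Submodule.Quotient.mk_smul]
    exact (Submodule.Quotient.mk_eq_zero _).2 (Ideal.mem_span_singleton'.2 ⟨1, by simp⟩))
  have h5 : (k u - i p) • x = 0 := h _ (by
    rw [sub_mul, hk', hu, map_smul, smul_eq_mul]; ring)
  have h6 : k u • x = b • g.hom p := by rw [← hg', hu, map_smul]
  refine ⟨g.hom p - r • x, ?_⟩
  rw [sub_smul, h6, hr, add_smul, one_smul, sub_eq_zero] at h5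
  rw [smul_sub, h5, smul_smul, mul_comm b r, add_sub_cancel_right]

theorem IsChainRing.exists_forall_dvd (hR : IsChainRing R) {ι : Type*} (s : Finset ι)
    (hs : s.Nonempty) (f : ι → R) : ∃ i ∈ s, ∀ j ∈ s, f i ∣ f j := by
  classical
  induction hs using Finset.Nonempty.cons_induction with
  | singleton a => exact ⟨a, by simp⟩
  | cons a s ha _ ih =>
    obtain ⟨i, hi, h⟩ := ih
    rcases hR.dvd_total (f a) (f i) with h' | h'
    · refine ⟨a, by simp, fun j hj => ?_⟩
      rcases Finset.mem_cons.1 hj with rfl | hj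
      · rfl
      · exact h'.trans (h j hj)
    · refine ⟨i, Finset.mem_cons_of_mem hi, fun j hj => ?_⟩
      rcases Finset.mem_cons.1 hj with rfl | hj
      · exact h'
      · exact h j hj

/-- Over a chain ring, homomorphisms to a divisible module extend from finitely generated
submodules of finite free modules. -/
theorem IsChainRing.exists_extension (hR : IsChainRing R)
    (hE : ∀ (b : R) (x : E), (∀ r, r * b = 0 → r • x = 0) → ∃ y, x = b • y)
    {κ : Type} [Fintype κ] (K : Submodule R (κ → R)) (ψ : K →ₗ[R] E) {ι : Type} [Fintype ι]
    (s : Finset κ) : ∀ g : ι → K, (∀ i, ∀ j ∉ s, (g i : κ → R) j = 0) →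
      ∃ φ : (κ → R) →ₗ[R] E, ∀ i, φ (g i) = ψ (g i) := by
  classical
  induction hn : s.card generalizing s with
  | zero =>
    intro g hg
    obtain rfl := Finset.card_eq_zero.1 hn
    refine ⟨0, fun i => ?_⟩
    have : g i = 0 := Subtype.ext (funext fun j => hg i j (by simp))
    simp [this]
  | succ n ih =>
    intro g hg
    rcases isEmpty_or_nonempty ι with hι | hι
    · exact ⟨0, fun i => isEmptyElim i⟩
    have hs : s.Nonempty := Finset.card_pos.1 (by lia)
    obtain ⟨⟨i₀, j₀⟩, hmem, hdvd⟩ := hR.exists_forall_dvd (Finset.univ ×ˢ s)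
      (Finset.univ_nonempty.product hs) (fun q => (g q.1 : κ → R) q.2)
    have hj₀ : j₀ ∈ s := (Finset.mem_product.1 hmem).2
    have hd : ∀ i j, (g i₀ : κ → R) j₀ ∣ (g i : κ → R) j := by
      intro i j
      by_cases hj : j ∈ s
      · exact hdvd (i, j) (by simp [hj])
      · rw [hg i j hj]; exact dvd_zero _
    choose c hc using fun i => hd i j₀
    obtain ⟨φ, hφ⟩ := ih (s.erase j₀) (by rw [Finset.card_erase_of_mem hj₀, hn]; rfl)
      (fun i => g i - c i • g i₀) (by
        intro i j hj
        by_cases hjj : j = j₀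
        · subst hjj
          simp [hc i, mul_comm]
        · have hjs : j ∉ s := fun h => hj (Finset.mem_erase.2 ⟨hjj, h⟩)
          simp [hg i j hjs, hg i₀ j hjs])
    obtain ⟨w, hw⟩ := hE ((g i₀ : κ → R) j₀) (ψ (g i₀) - φ (g i₀)) (by
      intro r hr
      have h0 : r • g i₀ = 0 := by
        refine Subtype.ext (funext fun j => ?_)
        obtain ⟨k, hk⟩ := hd i₀ j
        simp [hk, ← mul_assoc, hr]
      rw [smul_sub, ← map_smul, ← map_smul, ← Submodule.coe_smul, h0]
      simp)
    let Φ : (κ → R) →ₗ[R] E :=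
      φ + (LinearMap.toSpanSingleton R E w) ∘ₗ (LinearMap.proj j₀ : (κ → R) →ₗ[R] R)
    have h0 : Φ (g i₀) = ψ (g i₀) := by
      simp [Φ, ← hw]
    refine ⟨Φ, fun i => ?_⟩
    have h1 : Φ ((g i - c i • g i₀ : K) : κ → R) = ψ (g i - c i • g i₀) := by
      rw [LinearMap.add_apply, hφ i]
      simp [hc i, mul_comm]
    rw [Submodule.coe_sub, Submodule.coe_smul, map_sub, map_sub, map_smul, map_smul, h0] at h1
    exact sub_left_injective h1

theorem IsChainRing.isFPInjective (hR : IsChainRing R)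
    (hE : ∀ (b : R) (x : E), (∀ r, r * b = 0 → r • x = 0) → ∃ y, x = b • y) :
    IsFPInjective R E := by
  intro F hF
  let P := projectiveResolution F
  have h0 := ProjectiveResolution.projective_X P 0
  obtain ⟨π, hπ, hex⟩ := ProjectiveResolution.exists_augmentation P
  rw [isZero_ext_one_iff P]
  intro f hf
  obtain ⟨n, m, p, q, hp, hpq⟩ := Module.FinitePresentation.exists_fin' R F
  obtain ⟨i, hi⟩ := Module.projective_lifting_property π p hπ
  obtain ⟨j, hj⟩ := Module.projective_lifting_property p π hp
  have hi' : ∀ v, π (i v) = p v := LinearMap.congr_fun hi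
  have hj' : ∀ v, p (j v) = π v := LinearMap.congr_fun hj
  let d : P.complex.X 1 →ₗ[R] LinearMap.ker π :=
    (P.complex.d 1 0).hom.codRestrict _ fun u => hex.apply_apply_eq_zero u
  have hd : Function.Surjective d := by
    rintro ⟨v, hv⟩
    obtain ⟨u, rfl⟩ := (hex v).1 hv
    exact ⟨u, rfl⟩
  have hker : LinearMap.ker d ≤ LinearMap.ker f.hom := by
    intro u hu
    obtain ⟨t, rfl⟩ := (ProjectiveResolution.exact_hom_succ P 0 u).1 (congrArg Subtype.val hu)
    exact congrArg (fun φ => φ.hom t) hf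
  let φ : LinearMap.ker π →ₗ[R] E :=
    (LinearMap.ker d).liftQ f.hom hker ∘ₗ (d.quotKerEquivOfSurjective hd).symm.toLinearMap
  have hφ : ∀ u, φ (d u) = f.hom u := by
    intro u
    have : (d.quotKerEquivOfSurjective hd).symm (d u) = Submodule.Quotient.mk u := by
      rw [LinearEquiv.symm_apply_eq]; rfl
    change (LinearMap.ker d).liftQ f.hom hker ((d.quotKerEquivOfSurjective hd).symm (d u)) = _
    rw [this]; rfl
  let ι : LinearMap.ker p →ₗ[R] LinearMap.ker π :=
    i.restrict fun v hv => by rw [LinearMap.mem_ker, hi']; exact hv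
  obtain ⟨Ψ, hΨ⟩ := hR.exists_extension hE (LinearMap.ker p) (φ ∘ₗ ι) Finset.univ
    (fun t : Fin m => ⟨q (Pi.single t 1), hpq.apply_apply_eq_zero _⟩) (by simp)
  have hΨ' : ∀ v : LinearMap.ker p, Ψ v = φ (ι v) := by
    rintro ⟨v, hv⟩
    obtain ⟨t, rfl⟩ := (hpq v).1 hv
    let q' : (Fin m → R) →ₗ[R] LinearMap.ker p :=
      q.codRestrict _ fun u => hpq.apply_apply_eq_zero u
    have : Ψ ∘ₗ q = φ ∘ₗ ι ∘ₗ q' := by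
      refine (Pi.basisFun R (Fin m)).ext fun t => ?_
      rw [Pi.basisFun_apply]
      exact hΨ t
    exact LinearMap.congr_fun this t
  let e : P.complex.X 0 →ₗ[R] LinearMap.ker π :=
    (LinearMap.id - i ∘ₗ j).codRestrict _ fun v => by simp [hi', hj']
  refine ⟨ModuleCat.ofHom (Ψ ∘ₗ j + φ ∘ₗ e), ?_⟩
  ext u
  have hju : p (j (d u)) = 0 := by rw [hj']; exact (d u).2
  have h1 : Ψ (j (d u)) = φ (ι ⟨j (d u), hju⟩) := hΨ' ⟨_, hju⟩
  have h2 : e (d u) = d u - ι ⟨j (d u), hju⟩ := Subtype.ext rfl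
  change Ψ (j (d u)) + φ (e (d u)) = f.hom u
  rw [h1, h2, map_sub, hφ]
  abel

theorem Submodule.exists_smul_eq_of_rTensor_injective (D : Submodule R E) {z : R}
    (hD : Function.Injective (LinearMap.rTensor (R ⧸ Ideal.span {z}) D.subtype)) {v : E}
    (hv : z • v ∈ D) : ∃ w : D, z • v = z • (w : E) := by
  let B : (R ⧸ Ideal.span {z}) →ₗ[R] D →ₗ[R] D ⧸ LinearMap.range (LinearMap.lsmul R D z) :=
    (Ideal.span {z}).liftQ
      (LinearMap.toSpanSingleton R _ (LinearMap.range (LinearMap.lsmul R D z)).mkQ) (by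
        rw [Ideal.span_le, Set.singleton_subset_iff, SetLike.mem_coe, LinearMap.mem_ker]
        ext w
        exact (Submodule.Quotient.mk_eq_zero _).2 ⟨w, rfl⟩)
  have h1 : (⟨z • v, hv⟩ : D) ⊗ₜ[R] (Submodule.Quotient.mk 1 : R ⧸ Ideal.span {z}) = 0 := by
    apply hD
    rw [LinearMap.rTensor_tmul, map_zero, Submodule.subtype_apply, TensorProduct.smul_tmul,
      ← Submodule.Quotient.mk_smul,
      (Submodule.Quotient.mk_eq_zero (Ideal.span {z})).2 (Ideal.mem_span_singleton'.2 ⟨1, by simp⟩),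
      TensorProduct.tmul_zero]
  have h2 : B (Submodule.Quotient.mk 1) ⟨z • v, hv⟩ = 0 := by
    rw [← map_zero (TensorProduct.lift B.flip), ← h1, TensorProduct.lift.tmul, LinearMap.flip_apply]
  have h3 : B (Submodule.Quotient.mk 1) = (LinearMap.range (LinearMap.lsmul R D z)).mkQ := by
    rw [Submodule.liftQ_apply, LinearMap.toSpanSingleton_apply, one_smul]
  rw [h3, Submodule.mkQ_apply, Submodule.Quotient.mk_eq_zero] at h2
  obtain ⟨w, hw⟩ := h2
  exact ⟨w, (congrArg Subtype.val hw).symm⟩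

theorem IsAlmostFPInjective.annDivisible (hR : IsChainRing R) {G : Type u} [AddCommGroup G]
    [Module R G] (hG : IsAlmostFPInjective R G) : AnnDivisible R G := by
  obtain ⟨E, _, _, D, hE, hD, ⟨e⟩⟩ := hG
  intro x z b hzx hbz
  obtain ⟨v, hv⟩ := Submodule.mkQ_surjective D (e.symm x)
  have hzv : z • v ∈ D := by
    rw [← Submodule.Quotient.mk_eq_zero, ← Submodule.mkQ_apply, map_smul, hv, ← map_smul, hzx,
      map_zero]
  obtain ⟨w, hw⟩ := D.exists_smul_eq_of_rTensor_injective (hD (R ⧸ Ideal.span {z})) hzv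
  obtain ⟨y, hy⟩ := hE.exists_eq_smul (b := b) (x := v - w) (by
    intro r hr
    rcases hR.dvd_total z r with ⟨k, rfl⟩ | ⟨m, rfl⟩
    · rw [mul_comm, mul_smul, smul_sub, hw, sub_self, smul_zero]
    · exact absurd (by linear_combination m * hr) hbz)
  refine ⟨e (D.mkQ y), ?_⟩
  rw [← map_smul, ← map_smul, ← hy, map_sub, hv, map_sub, e.apply_symm_apply, Submodule.mkQ_apply,
    (Submodule.Quotient.mk_eq_zero D).2 w.2, map_zero, sub_zero]

/-- Over a chain ring, the total ring of fractions is divisible. -/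
theorem IsChainRing.exists_eq_smul_fractionRing (hR : IsChainRing R) {b : R}
    {q : FractionRing R} (h : ∀ r, r * b = 0 → r • q = 0) : ∃ y, q = b • y := by
  obtain ⟨⟨u, s⟩, hus⟩ := IsLocalization.surj (nonZeroDivisors R) q
  have hs := IsLocalization.map_units (FractionRing R) s
  simp only at hus
  have h' : ∀ r, r * b = 0 → r * u = 0 := by
    intro r hr
    apply IsLocalization.injective (FractionRing R) (le_refl (nonZeroDivisors R))
    rw [map_mul, ← hus, map_zero, ← mul_assoc, ← Algebra.smul_def, h r hr, zero_mul]
  have hdiv : ∀ y : FractionRing R, algebraMap R _ u = b • y → ∃ y, q = b • y := by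
    intro y hy
    obtain ⟨t, ht⟩ := hs.exists_right_inv
    refine ⟨t * y, ?_⟩
    rw [← mul_smul_comm, ← hy, ← hus, mul_left_comm, mul_comm t, ht, mul_one]
  rcases hR.dvd_total b u with ⟨k, rfl⟩ | ⟨m, rfl⟩
  · exact hdiv (algebraMap R _ k) (by rw [map_mul, Algebra.smul_def])
  · by_cases hm : m ∈ nonZeroDivisors R
    · obtain ⟨t, ht⟩ := (IsLocalization.map_units (FractionRing R)
        (⟨m, hm⟩ : nonZeroDivisors R)).exists_right_inv
      refine hdiv t ?_
      simp only at ht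
      rw [Algebra.smul_def, map_mul, mul_assoc, ht, mul_one]
    · rw [mem_nonZeroDivisors_iff_right] at hm
      push Not at hm
      obtain ⟨w, hw, hw0⟩ := hm
      by_cases hum : u * m = 0
      · have hu : u = 0 := by simpa using h' 1 (by rw [one_mul, hum])
        exact hdiv 0 (by simp [hu])
      · obtain ⟨e, he, he'⟩ := hR.exists_mul_ne_zero hw0 (by rwa [mul_comm]) hum
        exact absurd (h' e he') he

theorem isPureSubmodule_ker_of_flat {M : Type u} [AddCommGroup M] [Module R M] [Module.Flat R M]
    {p : E →ₗ[R] M} (hp : Function.Surjective p) : IsPureSubmodule (LinearMap.ker p) := by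
  intro N _ _
  rw [← LinearMap.lTensor_inj_iff_rTensor_inj]
  exact LinearMap.lTensor_injective_of_exact_of_flat p hp (LinearMap.ker p).subtype
    Subtype.val_injective (LinearMap.exact_subtype_ker_map p) N

theorem IsChainRing.isAlmostFPInjective_of_flat (hR : IsChainRing R) {M : Type u} [AddCommGroup M]
    [Module R M] [Module.Flat R M]
    (h : ∀ s : nonZeroDivisors R, IsUnit (algebraMap R (Module.End R M) s)) :
    IsAlmostFPInjective R M := by
  let Q := FractionRing R
  let S := nonZeroDivisors R
  let l : M → Q →ₗ[R] M := fun m =>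
    IsLocalizedModule.lift S (Algebra.linearMap R Q) (LinearMap.toSpanSingleton R M m) h
  let ψ : (M →₀ Q) →ₗ[R] M := Finsupp.lsum R l
  have hψ : Function.Surjective ψ := by
    intro m
    refine ⟨Finsupp.single m 1, ?_⟩
    have := IsLocalizedModule.lift_apply S (Algebra.linearMap R Q)
      (LinearMap.toSpanSingleton R M m) h 1
    simpa [ψ, l] using this
  refine ⟨M →₀ Q, inferInstance, inferInstance, LinearMap.ker ψ, ?_, ?_,
    ⟨ψ.quotKerEquivOfSurjective hψ⟩⟩
  · refine hR.isFPInjective fun b x hx => ?_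
    suffices x ∈ LinearMap.range (LinearMap.lsmul R (M →₀ Q) b) by
      obtain ⟨y, hy⟩ := this
      exact ⟨y, hy.symm⟩
    rw [← Finsupp.sum_single x]
    refine Submodule.sum_mem _ fun i _ => ?_
    obtain ⟨y, hy⟩ := hR.exists_eq_smul_fractionRing (b := b) (q := x i) fun r hr => by
      rw [← Finsupp.smul_apply, hx r hr, Finsupp.zero_apply]
    exact ⟨Finsupp.single i y, by simp [hy]⟩
  · exact isPureSubmodule_ker_of_flat hψ

theorem isUnit_end_tensorProduct_of_bijective {A : Type u} [AddCommGroup A] [Module R A]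
    (G : Type u) [AddCommGroup G] [Module R G] {s : R}
    (hs : Function.Bijective (LinearMap.lsmul R A s)) :
    IsUnit (algebraMap R (Module.End R (TensorProduct R A G)) s) := by
  have h : (algebraMap R (Module.End R (TensorProduct R A G)) s) =
      (LinearMap.lsmul R A s).rTensor G := by
    refine TensorProduct.ext' fun z g => ?_
    rw [Module.algebraMap_end_apply, LinearMap.rTensor_tmul, LinearMap.lsmul_apply,
      TensorProduct.smul_tmul']
  rw [Module.End.isUnit_iff, h]
  exact (TensorProduct.congr (LinearEquiv.ofBijective _ hs) (LinearEquiv.refl R G)).bijective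

theorem IsNoncoherentChain.isUnit_end_tensorProduct {Z : Ideal R} (hZ : IsNoncoherentChain Z)
    (G : Type u) [AddCommGroup G] [Module R G] (s : nonZeroDivisors R) :
    IsUnit (algebraMap R (Module.End R (TensorProduct R Z G)) s) := by
  refine isUnit_end_tensorProduct_of_bijective G ?_
  constructor
  · rw [injective_iff_map_eq_zero]
    rintro ⟨z, hz⟩ h
    exact Subtype.ext ((mem_nonZeroDivisors_iff_left.1 s.2) z (congrArg Subtype.val h))
  · rintro ⟨z, hz⟩
    rcases hZ.chain.dvd_total (s : R) z with ⟨k, rfl⟩ | ⟨k, hk⟩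
    · obtain ⟨w, hw, h⟩ := hZ.mem_iff.1 hz
      have hk : k ∈ Z := hZ.mem_iff.2 ⟨w, hw, (mem_nonZeroDivisors_iff_left.1 s.2) _ (by
        rw [← mul_assoc, h])⟩
      exact ⟨⟨k, hk⟩, rfl⟩
    · exfalso
      obtain ⟨w, hw, h⟩ := hZ.mem_iff.1 hz
      exact hw ((mem_nonZeroDivisors_iff_left.1 s.2) w (by rw [hk]; linear_combination k * h))

end FPInjective

section WeakDimension

variable {R : Type u} [CommRing R] {M F : Type u} [AddCommGroup M] [Module R M]
  [AddCommGroup F] [Module R F] [Module.Flat R F]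

section DimensionShift

variable {X₃ X₂ X₁ X₀ : Type u} [AddCommGroup X₃] [Module R X₃] [AddCommGroup X₂] [Module R X₂]
  [AddCommGroup X₁] [Module R X₁] [AddCommGroup X₀] [Module R X₀]
  {d₃ : X₃ →ₗ[R] X₂} {d₂ : X₂ →ₗ[R] X₁} {d₁ : X₁ →ₗ[R] X₀} {p : F →ₗ[R] M}

theorem lTensor_rTensor_comm {A B X Y : Type u} [AddCommGroup A] [Module R A] [AddCommGroup B]
    [Module R B] [AddCommGroup X] [Module R X] [AddCommGroup Y] [Module R Y]
    (f : A →ₗ[R] B) (d : X →ₗ[R] Y) (t : A ⊗[R] X) :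
    d.lTensor B (f.rTensor X t) = f.rTensor Y (d.lTensor A t) := by
  rw [← LinearMap.comp_apply, ← LinearMap.comp_apply, LinearMap.lTensor_comp_rTensor,
    LinearMap.rTensor_comp_lTensor]

theorem exists_eq_lTensor_ker (hp : Function.Surjective p) [Module.Flat R X₁]
    (h₂ : Function.Exact d₂ d₁)
    (hM : Function.Exact (d₃.lTensor M) (d₂.lTensor M))
    (h₃ : Function.Exact d₃ d₂) (k : LinearMap.ker p ⊗[R] X₁)
    (hk : d₁.lTensor F ((LinearMap.ker p).subtype.rTensor X₁ k) = 0) :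
    ∃ k', d₂.lTensor (LinearMap.ker p) k' = k := by
  have hex := fun X [AddCommGroup X] [Module R X] =>
    rTensor_exact (Q := X) (LinearMap.exact_subtype_ker_map p) hp
  obtain ⟨f, hf⟩ := (Module.Flat.lTensor_exact F h₂ _).1 hk
  obtain ⟨c, hc⟩ := (hM (p.rTensor X₂ f)).1 (by
    rw [lTensor_rTensor_comm, hf, (hex X₁).apply_apply_eq_zero])
  obtain ⟨f', rfl⟩ := LinearMap.rTensor_surjective X₃ hp c
  obtain ⟨k', hk'⟩ := (hex X₂ (f - d₃.lTensor F f')).1 (by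
    rw [map_sub, ← hc, lTensor_rTensor_comm, sub_self])
  refine ⟨k', Module.Flat.rTensor_preserves_injective_linearMap (M := X₁)
    (LinearMap.ker p).subtype Subtype.val_injective ?_⟩
  rw [← lTensor_rTensor_comm, hk', map_sub, hf,
    (Module.Flat.lTensor_exact F h₃).apply_apply_eq_zero, sub_zero]

theorem exact_lTensor_ker_iff (hp : Function.Surjective p) [Module.Flat R X₁] [Module.Flat R X₀]
    (h₃ : Function.Exact d₃ d₂) (h₂ : Function.Exact d₂ d₁) :
    Function.Exact (d₂.lTensor (LinearMap.ker p)) (d₁.lTensor (LinearMap.ker p)) ↔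
      Function.Exact (d₃.lTensor M) (d₂.lTensor M) := by
  have hex := fun X [AddCommGroup X] [Module R X] =>
    rTensor_exact (Q := X) (LinearMap.exact_subtype_ker_map p) hp
  constructor
  · intro h c
    constructor
    · intro hc
      obtain ⟨f, rfl⟩ := LinearMap.rTensor_surjective X₂ hp c
      rw [lTensor_rTensor_comm] at hc
      obtain ⟨k, hk⟩ := (hex X₁ _).1 hc
      obtain ⟨k', rfl⟩ := (h k).1 (by
        apply Module.Flat.rTensor_preserves_injective_linearMap (M := X₀)
          (LinearMap.ker p).subtype Subtype.val_injective
        rw [← lTensor_rTensor_comm, hk, (Module.Flat.lTensor_exact F h₂).apply_apply_eq_zero,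
          map_zero])
      obtain ⟨f', hf'⟩ := (Module.Flat.lTensor_exact F h₃
        (f - (LinearMap.ker p).subtype.rTensor X₂ k')).1 (by
          rw [map_sub, lTensor_rTensor_comm, hk, sub_self])
      refine ⟨p.rTensor X₃ f', ?_⟩
      rw [lTensor_rTensor_comm, hf', map_sub, (hex X₂).apply_apply_eq_zero, sub_zero]
    · rintro ⟨c', rfl⟩
      rw [← LinearMap.comp_apply, ← LinearMap.lTensor_comp, h₃.linearMap_comp_eq_zero,
        LinearMap.lTensor_zero, LinearMap.zero_apply]
  · intro h k
    constructor
    · intro hk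
      exact exists_eq_lTensor_ker hp h₂ h h₃ k (by rw [lTensor_rTensor_comm, hk, map_zero])
    · rintro ⟨k', rfl⟩
      rw [← LinearMap.comp_apply, ← LinearMap.lTensor_comp, h₂.linearMap_comp_eq_zero,
        LinearMap.lTensor_zero, LinearMap.zero_apply]

end DimensionShift

/-- The vanishing of `Tor_{n+1}(M, N)` for all modules `N`. -/
def TorVanishes (R M : Type u) [CommRing R] [AddCommGroup M] [Module R M] (n : ℕ) : Prop :=
  ∀ N : ModuleCat.{u} R,
    Limits.IsZero (((Tor (ModuleCat.{u} R) (n + 1)).obj (ModuleCat.of R M)).obj N)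

theorem torVanishes_ker_iff {p : F →ₗ[R] M} (hp : Function.Surjective p) (n : ℕ) :
    TorVanishes R (LinearMap.ker p) n ↔ TorVanishes R M (n + 1) := by
  refine forall_congr' fun N => ?_
  let P := projectiveResolution N
  have h1 := ProjectiveResolution.projective_X P (n + 1)
  have h0 := ProjectiveResolution.projective_X P n
  rw [isZero_tor_succ_iff P, isZero_tor_succ_iff P]
  exact exact_lTensor_ker_iff hp (ProjectiveResolution.exact_hom_succ P (n + 1))
    (ProjectiveResolution.exact_hom_succ P n)

theorem torVanishes_zero_of_flat [Module.Flat R M] : TorVanishes R M 0 := fun N => by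
  rw [isZero_tor_succ_iff (projectiveResolution N)]
  exact Module.Flat.lTensor_exact M (ProjectiveResolution.exact_hom_succ _ 0)

theorem isPureSubmodule_ker_of_torVanishes {p : F →ₗ[R] M} (hp : Function.Surjective p)
    (h : TorVanishes R M 0) : IsPureSubmodule (LinearMap.ker p) := by
  intro N _ _
  let P := projectiveResolution (ModuleCat.of R N)
  have h0 := ProjectiveResolution.projective_X P 0
  obtain ⟨π, hπ, hex⟩ := ProjectiveResolution.exists_augmentation P
  rw [injective_iff_map_eq_zero]
  intro t ht
  obtain ⟨k, rfl⟩ := LinearMap.lTensor_surjective (LinearMap.ker p) hπ t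
  obtain ⟨k', rfl⟩ := exists_eq_lTensor_ker hp hex
    ((isZero_tor_succ_iff P 0 M).1 (h (ModuleCat.of R N)))
    (ProjectiveResolution.exact_hom_succ P 0) k (by rw [lTensor_rTensor_comm]; exact ht)
  rw [← LinearMap.comp_apply, ← LinearMap.lTensor_comp, hex.linearMap_comp_eq_zero,
    LinearMap.lTensor_zero, LinearMap.zero_apply]

theorem IsChainRing.torVanishes_zero_iff (hR : IsChainRing R) :
    TorVanishes R M 0 ↔ Module.Flat R M := by
  refine ⟨fun h => hR.flat_of_forall_smul_eq_zero fun a m ham => ?_,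
    fun _ => torVanishes_zero_of_flat⟩
  let p : (M →₀ R) →ₗ[R] M := Finsupp.linearCombination R id
  have hp : Function.Surjective p := Finsupp.linearCombination_id_surjective R M
  obtain ⟨f, rfl⟩ := hp m
  obtain ⟨w, hw⟩ := (LinearMap.ker p).exists_smul_eq_of_rTensor_injective
    (isPureSubmodule_ker_of_torVanishes hp h (R ⧸ Ideal.span {a}))
    (v := f) (z := a) (by rw [LinearMap.mem_ker, map_smul, ham])
  obtain ⟨c, hc, g, hg⟩ := hR.exists_of_flat (a := a) (m := f - w) (by
    rw [smul_sub, hw, sub_self])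
  refine ⟨c, hc, p g, ?_⟩
  rw [← map_smul, ← hg, map_sub, LinearMap.mem_ker.1 w.2, sub_zero]

theorem IsChainRing.weakDim_eq_zero (hR : IsChainRing R) [Module.Flat R M] :
    weakDim R M = 0 :=
  nonpos_iff_eq_zero.1 (sInf_le ⟨0, rfl, hR.torVanishes_zero_iff.2 inferInstance⟩)

theorem IsNoncoherentChain.weakDim_eq_two {Z : Ideal R} (hZ : IsNoncoherentChain Z)
    (hM : AnnDivisible R M) (h : ¬ Module.Flat R M) : weakDim R M = 2 := by
  let p : (M →₀ R) →ₗ[R] M := Finsupp.linearCombination R id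
  have hp : Function.Surjective p := Finsupp.linearCombination_id_surjective R M
  let q : (LinearMap.ker p →₀ R) →ₗ[R] LinearMap.ker p := Finsupp.linearCombination R id
  have hq : Function.Surjective q := Finsupp.linearCombination_id_surjective R _
  apply le_antisymm
  · refine sInf_le ⟨2, rfl, ?_⟩
    have := hZ.flat_ker_ker hM p hp q hq
    exact (torVanishes_ker_iff hp 1).1 ((torVanishes_ker_iff hq 0).1 torVanishes_zero_of_flat)
  · refine le_sInf ?_
    rintro _ ⟨k, rfl, hk⟩
    have h2 : 2 ≤ k := by
      by_contra! hk2
      interval_cases k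
      · exact h (hZ.chain.torVanishes_zero_iff.1 hk)
      · have := hZ.chain.torVanishes_zero_iff.1 ((torVanishes_ker_iff hp 0).2 hk)
        exact h (hZ.flat_of_flat_ker hM p hp)
    exact_mod_cast h2

end WeakDimension

theorem algebraMap_mem_span_singleton_iff {R : Type u} [CommRing R] {a r : R} :
    algebraMap R (FractionRing R) r ∈ Ideal.span {algebraMap R (FractionRing R) a} ↔
      ∃ s ∈ nonZeroDivisors R, ∃ r', s * r = a * r' := by
  rw [Ideal.mem_span_singleton']
  constructor
  · rintro ⟨q, hq⟩
    obtain ⟨⟨u, s⟩, hus⟩ := IsLocalization.surj (nonZeroDivisors R) q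
    refine ⟨s, s.2, u, IsLocalization.injective (FractionRing R) (le_refl (nonZeroDivisors R)) ?_⟩
    simp only at hus
    rw [map_mul, map_mul, ← hus, ← hq]
    ring
  · rintro ⟨s, hs, r', h⟩
    obtain ⟨t, ht⟩ := (IsLocalization.map_units (FractionRing R)
      (⟨s, hs⟩ : nonZeroDivisors R)).exists_right_inv
    simp only at ht
    have h' := congrArg (algebraMap R (FractionRing R)) h
    rw [map_mul, map_mul] at h'
    refine ⟨t * algebraMap R _ r', ?_⟩
    linear_combination (-t) * h' + algebraMap R (FractionRing R) r * ht

/-- Let `R` be a chain ring which is not semicoherent, with ideal of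
zero-divisors `Z` and fraction ring `Q = R_Z`, and let `G` be a nonzero almost
FP-injective module. Then `Z ⊗_R G` is flat and almost FP-injective, and:
(a) `w.d.(G) = 2` if `Z ⊊ G_♯`; (b) `w.d.(G) = 0` if `G_♯ ∪ G^♯ ⊊ Z`;
(c) if `G_♯ ∪ G^♯ = Z` then `w.d.(G) = 0` or `w.d.(G) = 2`; more precisely `G` is flat
iff for every `0 ≠ x ∈ G` the annihilator `(0 : x)` is not of the form `Qa` for some
`0 ≠ a ∈ Z`. -/
theorem weakDim_of_almostFPInjective_not_semicoherent (R : Type u) [CommRing R]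
    (hR : IsChainRing R) (hns : ¬ IsSemicoherent R)
    (Z : Ideal R) (hZ : (Z : Set R) = zeroDivisorsSet R)
    (G : Type u) [AddCommGroup G] [Module R G] [Nontrivial G]
    (hG : IsAlmostFPInjective R G) :
    Module.Flat R (TensorProduct R Z G) ∧
    IsAlmostFPInjective R (TensorProduct R Z G) ∧
    ((Z : Set R) ⊂ bottomSet R G → weakDim R G = 2) ∧
    (bottomSet R G ∪ topSet R G ⊂ (Z : Set R) → weakDim R G = 0) ∧
    (bottomSet R G ∪ topSet R G = (Z : Set R) →
      (weakDim R G = 0 ∨ weakDim R G = 2) ∧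
      (Module.Flat R G ↔ ∀ x : G, x ≠ 0 →
        ¬ ∃ a : R, a ≠ 0 ∧ a ∈ Z ∧
          Ideal.torsionOf R G x =
            Ideal.comap (algebraMap R (FractionRing R))
              (Ideal.span {algebraMap R (FractionRing R) a}))) := by
  have hZ' : ∀ {z : R}, z ∈ Z ↔ ∃ s, s ≠ 0 ∧ z * s = 0 := fun {z} => Set.ext_iff.1 hZ z
  have hN : IsNoncoherentChain Z := hR.isNoncoherentChain hns hZ'
  have hM : AnnDivisible R G := hG.annDivisible hR
  have hfl : Module.Flat R (TensorProduct R Z G) := hN.flat_tensorProduct hM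
  refine ⟨hfl, hR.isAlmostFPInjective_of_flat (hN.isUnit_end_tensorProduct G), ?_, ?_, ?_⟩
  · intro h
    refine hN.weakDim_eq_two hM fun _ => ?_
    obtain ⟨s, ⟨x, hx, hsx⟩, hs⟩ := Set.exists_of_ssubset h
    obtain ⟨c, hc, y, rfl⟩ := hR.exists_of_flat hsx
    refine hx ?_
    have hc0 : c = 0 := hN.eq_zero_of_notMem (s := s) hs (by rw [mul_comm, hc])
    rw [hc0, zero_smul]
  · intro h
    have := hN.flat_of_ssubset hM h
    exact hR.weakDim_eq_zero
  · intro h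
    constructor
    · by_cases hflat : Module.Flat R G
      · exact Or.inl hR.weakDim_eq_zero
      · exact Or.inr (hN.weakDim_eq_two hM hflat)
    · have hs : ∀ s : R, s ∈ nonZeroDivisors R ↔ s ∉ Z := by
        intro s
        rw [hZ', mem_nonZeroDivisors_iff_left]
        push Not
        exact ⟨fun H t ht h0 => ht (H t h0), fun H t h0 => by_contra fun ht => H t ht h0⟩
      rw [hN.flat_iff_torsionOf hM (h ▸ Set.subset_union_left)]
      refine forall₂_congr fun x _ => not_congr (exists_congr fun a =>
        and_congr_right fun _ => and_congr_right fun _ => ?_)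
      rw [SetLike.ext_iff]
      refine forall_congr' fun r => ?_
      rw [Ideal.mem_torsionOf_iff, Ideal.mem_comap, algebraMap_mem_span_singleton_iff]
      simp only [hs]
end
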